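/- arXiv:1110.4379 — 2 statements merged into one kernel-verified Lean document; each statement's English description precedes it below -/
import Mathlib

section
/- For every integer n ≥ 0, the number of permutations π of {1, 2, …, n} that avoid the pattern 321 (i.e., there is no triple of indices i < j < k with π(i) > π(j) > π(k)) equals the n-th Catalan number C_n = (2n)!/(n!·(n+1)!). -/
/-- A permutation `π` of `Fin n` (representing `{1, …, n}`) has an occurrence of the
pattern 321 at the triple of indices `(t.1, t.2.1, t.2.2)` if the indices are increasing
and the corresponding values are strictly decreasing. -/
def Occ321 {n : ℕ} (π : Equiv.Perm (Fin n)) (t : Fin n × Fin n × Fin n) : Prop :=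
  t.1 < t.2.1 ∧ t.2.1 < t.2.2 ∧ π t.2.1 < π t.1 ∧ π t.2.2 < π t.2.1

/-- `π` avoids the pattern 321. -/
def Avoids321 {n : ℕ} (π : Equiv.Perm (Fin n)) : Prop :=
  ¬ ∃ t : Fin n × Fin n × Fin n, Occ321 π t

/-- The last `j` entries of `π` are increasing. -/
def IncreasingSuffix {n : ℕ} (π : Equiv.Perm (Fin n)) (j : ℕ) : Prop :=
  ∀ i i' : Fin n, n ≤ i + j → i < i' → π i < π i'

/-- The permutation obtained from `σ` by inserting a new largest value at position `p`. -/
def insertMax {n : ℕ} (p : Fin (n + 1)) (σ : Equiv.Perm (Fin n)) : Equiv.Perm (Fin (n + 1)) :=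
  (finSuccEquiv' p).trans ((Equiv.optionCongr σ).trans (finSuccEquiv' (Fin.last n)).symm)

@[simp] lemma insertMax_self {n : ℕ} (p : Fin (n + 1)) (σ : Equiv.Perm (Fin n)) :
    insertMax p σ p = Fin.last n := by
  simp [insertMax]

@[simp] lemma insertMax_succAbove {n : ℕ} (p : Fin (n + 1)) (σ : Equiv.Perm (Fin n)) (i : Fin n) :
    insertMax p σ (p.succAbove i) = (σ i).castSucc := by
  simp [insertMax]

lemma insertMax_bijective (n : ℕ) :
    Function.Bijective fun x : Fin (n + 1) × Equiv.Perm (Fin n) ↦ insertMax x.1 x.2 := by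
  rw [Fintype.bijective_iff_injective_and_card]
  refine ⟨?_, by simp [Fintype.card_perm, Nat.factorial_succ]⟩
  rintro ⟨p, σ⟩ ⟨q, τ⟩ h
  have hpq : p = q := by
    apply (insertMax p σ).injective
    rw [insertMax_self, show insertMax p σ = insertMax q τ from h, insertMax_self]
  subst hpq
  congr 1
  ext i : 1
  have := congrArg (fun π ↦ π (p.succAbove i)) h
  simpa using this

lemma avoids321_iff {n : ℕ} (π : Equiv.Perm (Fin n)) :
    Avoids321 π ↔ ∀ i j k, i < j → j < k → π j < π i → ¬ π k < π j := by
  simp only [Avoids321, Occ321, Prod.exists, not_exists, not_and]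

lemma avoids321_insertMax_iff {n : ℕ} (p : Fin (n + 1)) (σ : Equiv.Perm (Fin n)) :
    Avoids321 (insertMax p σ) ↔ Avoids321 σ ∧ IncreasingSuffix σ (n - p) := by
  simp only [avoids321_iff]
  constructor
  · refine fun h ↦ ⟨fun i j k hij hjk h₁ h₂ ↦ ?_, fun i i' hi hii ↦ ?_⟩
    · exact h (p.succAbove i) (p.succAbove j) (p.succAbove k) (by simpa) (by simpa) (by simpa)
        (by simpa)
    · by_contra hc
      have hne : σ i ≠ σ i' := fun e ↦ hii.ne (σ.injective e)
      refine h p (p.succAbove i) (p.succAbove i') ?_ (by simpa) (by simp) ?_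
      · rw [Fin.lt_succAbove_iff_le_castSucc, Fin.le_def, Fin.val_castSucc]
        omega
      · simpa using lt_of_le_of_ne (not_lt.1 hc) hne.symm
  · rintro ⟨h, hs⟩ i j k hij hjk h₁ h₂
    induction j using Fin.succAboveCases p with
    | x => exact absurd h₁ (by simp [Fin.le_last])
    | p j =>
    induction k using Fin.succAboveCases p with
    | x => exact absurd h₂ (by simp [Fin.le_last])
    | p k =>
    simp only [insertMax_succAbove, Fin.castSucc_lt_castSucc_iff, Fin.succAbove_lt_succAbove_iff]
      at h₂ hjk
    induction i using Fin.succAboveCases p with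
    | x =>
      rw [Fin.lt_succAbove_iff_le_castSucc, Fin.le_def, Fin.val_castSucc] at hij
      exact lt_asymm h₂ (hs j k (by omega) hjk)
    | p i => exact h i j k (by simpa using hij) hjk (by simpa using h₁) h₂

lemma increasingSuffix_insertMax_iff {n : ℕ} (p : Fin (n + 1)) (σ : Equiv.Perm (Fin n)) (j : ℕ)
    (hσ : IncreasingSuffix σ (n - p)) :
    IncreasingSuffix (insertMax p σ) (j + 1) ↔
      if n - (p : ℕ) = 0 then IncreasingSuffix σ j else j < n - p := by
  split_ifs with hp
  · obtain rfl : p = Fin.last n := by ext; simp; omega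
    constructor
    · intro h i i' hi hii
      have := h ((Fin.last n).succAbove i) ((Fin.last n).succAbove i')
        (by simp; omega) (by simpa)
      rwa [insertMax_succAbove, insertMax_succAbove, Fin.castSucc_lt_castSucc_iff] at this
    · intro h i i' hi hii
      induction i using Fin.succAboveCases (Fin.last n) with
      | x => exact absurd hii (by simp [Fin.le_last])
      | p i =>
      induction i' using Fin.succAboveCases (Fin.last n) with
      | x =>
        rw [insertMax_succAbove, insertMax_self]
        exact Fin.castSucc_lt_last _
      | p i' =>
        rw [insertMax_succAbove, insertMax_succAbove, Fin.castSucc_lt_castSucc_iff]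
        exact h i i' (by simp at hi; omega) (by simpa using hii)
  · constructor
    · intro h
      by_contra hc
      have := h p (Fin.last n) (by omega) (by rw [Fin.lt_def, Fin.val_last]; omega)
      exact absurd this (by simp [Fin.le_last])
    · intro hj i i' hi hii
      have hpi : p < i := by rw [Fin.lt_def]; omega
      induction i using Fin.succAboveCases p with
      | x => exact absurd hpi (lt_irrefl _)
      | p i =>
      induction i' using Fin.succAboveCases p with
      | x => exact absurd hpi (lt_asymm hii)
      | p i' =>
        rw [insertMax_succAbove, insertMax_succAbove, Fin.castSucc_lt_castSucc_iff]
        rw [Fin.lt_succAbove_iff_le_castSucc, Fin.le_def, Fin.val_castSucc] at hpi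
        exact hσ i i' (by omega) (by simpa using hii)

open Classical in
/-- The number of 321-avoiding permutations whose last `j` entries are increasing. -/
noncomputable def suffixCount (n j : ℕ) : ℕ :=
  Fintype.card {π : Equiv.Perm (Fin n) // Avoids321 π ∧ IncreasingSuffix π j}

lemma suffixCount_succ_succ (n j : ℕ) :
    suffixCount (n + 1) (j + 1) =
      ∑ q ∈ Finset.range (n + 1),
        if q = 0 then suffixCount n j else if j < q then suffixCount n q else 0 := by
  classical
  have e : {x : Fin (n + 1) × Equiv.Perm (Fin n) // Avoids321 (insertMax x.1 x.2) ∧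
      IncreasingSuffix (insertMax x.1 x.2) (j + 1)} ≃
      {π : Equiv.Perm (Fin (n + 1)) // Avoids321 π ∧ IncreasingSuffix π (j + 1)} :=
    (Equiv.ofBijective _ (insertMax_bijective n)).subtypeEquiv fun _ ↦ Iff.rfl
  rw [suffixCount, ← Fintype.card_congr e, Fintype.card_subtype, ← Finset.sum_range_reflect,
    Finset.sum_range, Finset.card_filter, Fintype.sum_prod_type]
  refine Finset.sum_congr rfl fun p _ ↦ ?_
  simp only [suffixCount, Fintype.card_subtype, Nat.add_sub_cancel]
  rw [← Finset.card_filter]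
  have key (σ : Equiv.Perm (Fin n)) : (Avoids321 (insertMax p σ) ∧
      IncreasingSuffix (insertMax p σ) (j + 1)) ↔ (Avoids321 σ ∧ IncreasingSuffix σ (n - p)) ∧
        if n - (p : ℕ) = 0 then IncreasingSuffix σ j else j < n - p := by
    rw [avoids321_insertMax_iff]
    exact and_congr_right fun h ↦ increasingSuffix_insertMax_iff p σ j h.2
  simp only [key]
  split_ifs with h₁ h₂
  · congr 1
    ext σ
    simp only [Finset.mem_filter, Finset.mem_univ, true_and, h₁]
    have : IncreasingSuffix σ 0 := fun i _ hi ↦ absurd i.isLt (by omega)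
    tauto
  · simp [h₂]
  · simp [h₂]

lemma suffixCount_zero_right (n : ℕ) : suffixCount n 0 = suffixCount n 1 := by
  classical
  have (π : Equiv.Perm (Fin n)) : IncreasingSuffix π 0 ↔ IncreasingSuffix π 1 :=
    ⟨fun _ i i' hi hii ↦ by rw [Fin.lt_def] at hii; omega, fun _ i _ hi ↦ by omega⟩
  simp only [suffixCount, this]

lemma suffixCount_zero_left (j : ℕ) : suffixCount 0 j = 1 := by
  classical
  rw [suffixCount, Fintype.card_eq_one_iff]
  refine ⟨⟨1, ?_, fun i ↦ i.elim0⟩, fun _ ↦ Subsingleton.elim _ _⟩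
  rintro ⟨⟨i, _⟩, _⟩
  exact i.elim0

lemma suffixCount_self (n : ℕ) : suffixCount n n = 1 := by
  cases n with
  | zero => exact suffixCount_zero_left 0
  | succ n =>
  induction n with
  | zero => simp [suffixCount_succ_succ, suffixCount_zero_left]
  | succ n ih =>
    rw [suffixCount_succ_succ, Finset.sum_eq_single 0]
    · simpa using ih
    · intro q hq hq0
      rw [if_neg hq0, if_neg (by have := Finset.mem_range.1 hq; omega)]
    · simp

lemma suffixCount_succ_eq_add {n j : ℕ} (hj : j < n) :
    suffixCount (n + 1) (j + 1) = suffixCount (n + 1) (j + 2) + suffixCount n j := by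
  have h (k : ℕ) : suffixCount (n + 1) (k + 1) = (∑ q ∈ Finset.range n,
      if k < q + 1 then suffixCount n (q + 1) else 0) + suffixCount n k := by
    rw [suffixCount_succ_succ, Finset.sum_range_succ']
    simp
  rw [h, h]
  congr 1
  rw [← Finset.sum_erase_add _ _ (Finset.mem_range.2 hj),
    ← Finset.sum_erase_add _ (fun q ↦ if j + 1 < q + 1 then _ else _) (Finset.mem_range.2 hj)]
  simp only [lt_irrefl, if_false, lt_add_iff_pos_right, zero_lt_one, if_true, add_zero]
  congr 1
  refine Finset.sum_congr rfl fun q hq ↦ ?_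
  have hqj : q ≠ j := Finset.ne_of_mem_erase hq
  have : j < q + 1 ↔ j + 1 < q + 1 := by omega
  simp only [this]

lemma suffixCount_add_choose (n d j : ℕ) (h : j + d = n) :
    suffixCount n j + (2 * n - j).choose (n + 1) = (2 * n - j).choose n := by
  induction n generalizing d j with
  | zero => obtain rfl : j = 0 := by omega
            simp [suffixCount_zero_left]
  | succ n ihn =>
    have main (d : ℕ) : ∀ j, j + d = n → suffixCount (n + 1) (j + 1) +
        (2 * (n + 1) - (j + 1)).choose (n + 2) = (2 * (n + 1) - (j + 1)).choose (n + 1) := by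
      induction d with
      | zero =>
        rintro j rfl
        rw [add_zero, suffixCount_self, show 2 * (j + 1) - (j + 1) = j + 1 by omega]
        simp
      | succ d ih =>
        intro j hj
        have h₁ := ih (j + 1) (by omega)
        have h₂ := ihn (d + 1) j hj
        rw [suffixCount_succ_eq_add (by omega)]
        obtain ⟨m, hm⟩ : ∃ m, 2 * n - j = m := ⟨_, rfl⟩
        rw [show 2 * (n + 1) - (j + 1 + 1) = m by omega] at h₁
        rw [hm] at h₂
        rw [show 2 * (n + 1) - (j + 1) = m + 1 by omega, Nat.choose_succ_succ,
          Nat.choose_succ_succ]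
        simp only [Nat.succ_eq_add_one, add_assoc, Nat.reduceAdd] at *
        omega
    rcases j with _ | j
    · have := main n 0 (by omega)
      rw [suffixCount_zero_right]
      rw [show 2 * (n + 1) - 0 = (2 * n + 1) + 1 by omega,
        Nat.choose_succ_succ (2 * n + 1) (n + 1), Nat.choose_succ_succ (2 * n + 1) n]
      rw [show 2 * (n + 1) - (0 + 1) = 2 * n + 1 by omega] at this
      have hs : (2 * n + 1).choose n = (2 * n + 1).choose (n + 1) := Nat.choose_symm_half n |>.symm
      simp only [Nat.succ_eq_add_one, zero_add, add_assoc, Nat.reduceAdd] at *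
      omega
    · exact main d j (by omega)

theorem count_avoiders_eq_catalan (n : ℕ) :
    Nat.card {π : Equiv.Perm (Fin n) // Avoids321 π} =
      (2 * n).factorial / (n.factorial * (n + 1).factorial) := by
  classical
  have hcard : Nat.card {π : Equiv.Perm (Fin n) // Avoids321 π} = suffixCount n 0 := by
    rw [suffixCount, Nat.card_eq_fintype_card]
    refine Fintype.card_congr (Equiv.subtypeEquivRight fun π ↦ ?_)
    exact (and_iff_left fun i _ hi ↦ absurd i.isLt (by omega)).symm
  have h := suffixCount_add_choose n n 0 (by omega)
  have h₁ : (2 * n).choose (n + 1) * (n + 1) = (2 * n).choose n * n := by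
    rw [Nat.choose_succ_right_eq]; congr 1; omega
  have h₂ : (2 * n).choose n * n.factorial * n.factorial = (2 * n).factorial := by
    have := Nat.choose_mul_factorial_mul_factorial (show n ≤ 2 * n by omega)
    rwa [show 2 * n - n = n by omega] at this
  rw [Nat.sub_zero] at h
  have h₃ : suffixCount n 0 * (n + 1) = (2 * n).choose n := by nlinarith
  rw [hcard]
  refine (Nat.div_eq_of_eq_mul_left (by positivity) ?_).symm
  rw [← h₂, ← h₃, Nat.factorial_succ]
  ring
end

section
/- For every integer n ≥ 1 and every integer b with 2 ≤ b ≤ n−1, there is a bijection between the set of permutations π of {1, …, n} containing the pattern 321 exactly once whose unique occurrence (c, b', a) (with c > b' > a the pattern values) satisfies b' = b, and the set of pairs (σ₁, σ₂) where σ₁ is a 321-avoiding permutation of {1, …, b} with σ₁(b) ≠ b and σ₂ is a 321-avoiding permutation of {b, b+1, …, n} with σ₂(1) ≠ b. In particular, the number of such permutations π equals (C_b − C_{b−1})·(C_{n−b+1} − C_{n−b}). -/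
/-- `π` contains the pattern 321 exactly once. -/
def ExactlyOne321 {n : ℕ} (π : Equiv.Perm (Fin n)) : Prop :=
  ∃! t : Fin n × Fin n × Fin n, Occ321 π t

/-- `f` restricts to a permutation of `{0, …, n - 1}`. -/
def PermutesBelow (n : ℕ) (f : ℕ → ℕ) : Prop :=
  (∀ i < n, f i < n) ∧ ∀ i < n, ∀ j < n, f i = f j → i = j

/-- `f` has no occurrence of 321 among the indices below `n`. -/
def AvoidsBelow (n : ℕ) (f : ℕ → ℕ) : Prop :=
  ∀ i j k, i < j → j < k → k < n → f k < f j → f j < f i → False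

/-- `(p, j, q)` is the only occurrence of 321 in `f` among the indices below `n`. -/
def OnlyOccBelow (n : ℕ) (f : ℕ → ℕ) (p j q : ℕ) : Prop :=
  p < j ∧ j < q ∧ q < n ∧ f q < f j ∧ f j < f p ∧
    ∀ i s k, i < s → s < k → k < n → f k < f s → f s < f i → i = p ∧ s = j ∧ k = q

lemma PermutesBelow.exists_eq {n : ℕ} {f : ℕ → ℕ} (hf : PermutesBelow n f) {y : ℕ} (hy : y < n) :
    ∃ x < n, f x = y := by
  have h := Finset.surj_on_of_inj_on_of_card_le (s := Finset.range n) (t := Finset.range n)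
    (fun a _ => f a) (fun a ha => by simpa using hf.1 a (by simpa using ha))
    (fun a b ha hb hab => hf.2 a (by simpa using ha) b (by simpa using hb) hab) le_rfl
    y (by simpa using hy)
  obtain ⟨x, hx, rfl⟩ := h
  exact ⟨x, by simpa using hx, rfl⟩

/-- Glue `g` on `{0, …, m}` and `h` on `{0, 1, …}`, shifted by `m`, at the fixed point `m`: the value
`m` of `g` is replaced by the first value of `h`, and the value `m` of the shifted `h` by the last
value of `g`. -/
def glue (m : ℕ) (g h : ℕ → ℕ) (i : ℕ) : ℕ :=
  if i < m then (if g i = m then m + h 0 else g i)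
  else if i = m then m
  else if h (i - m) = 0 then g m else m + h (i - m)

section Glue

variable {m c : ℕ} {g h : ℕ → ℕ}

lemma glue_of_lt {i : ℕ} (hi : i < m) :
    glue m g h i = if g i = m then m + h 0 else g i := if_pos hi

lemma glue_self : glue m g h m = m := by simp [glue]

lemma glue_add {i : ℕ} (hi : 0 < i) :
    glue m g h (m + i) = if h i = 0 then g m else m + h i := by
  have h1 : ¬ m + i < m := by omega
  have h2 : m + i ≠ m := by omega
  simp [glue, h1, hi.ne']

lemma permutesBelow_glue (hc : 0 < c) (hg : PermutesBelow (m + 1) g) (hh : PermutesBelow c h)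
    (hgm : g m ≠ m) (hh0 : h 0 ≠ 0) : PermutesBelow (m + c) (glue m g h) := by
  have hgm' := hg.1 m (by omega)
  have hh0' := hh.1 0 hc
  constructor
  · intro i hi
    rcases lt_trichotomy i m with him | rfl | him
    · have := hg.1 i (by omega)
      rw [glue_of_lt him]; split_ifs <;> omega
    · rw [glue_self]; omega
    · obtain ⟨j, rfl⟩ := Nat.exists_eq_add_of_lt him
      have := hh.1 (j + 1) (by omega)
      rw [add_assoc, glue_add (by omega)]; split_ifs <;> omega
  · have key : ∀ i < m + c, ∀ j < m + c, i < j → glue m g h i ≠ glue m g h j := by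
      intro i hi j hj hij
      rcases lt_trichotomy j m with hjm | rfl | hjm
      · have hi' := hg.1 i (by omega)
        have hj' := hg.1 j (by omega)
        have := hg.2 i (by omega) j (by omega)
        rw [glue_of_lt hjm, glue_of_lt (by omega)]; split_ifs <;> omega
      · have hi' := hg.1 i (by omega)
        rw [glue_self, glue_of_lt hij]; split_ifs <;> omega
      · obtain ⟨j, rfl⟩ := Nat.exists_eq_add_of_lt hjm
        rw [add_assoc, glue_add (by omega)]
        rcases lt_trichotomy i m with him | rfl | him
        · have hi' := hg.1 i (by omega)
          have := hg.2 i (by omega) m (by omega)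
          have := hh.2 0 (by omega) (j + 1) (by omega)
          rw [glue_of_lt him]; split_ifs <;> omega
        · rw [glue_self]; split_ifs <;> omega
        · obtain ⟨i, rfl⟩ := Nat.exists_eq_add_of_lt him
          have := hh.2 (i + 1) (by omega) (j + 1) (by omega)
          rw [add_assoc, glue_add (by omega)]; split_ifs <;> omega
    intro i hi j hj hij
    by_contra hne
    rcases lt_or_gt_of_ne hne with hlt | hlt
    · exact key i hi j hj hlt hij
    · exact key j hj i hi hlt hij.symm

lemma exists_onlyOccBelow_glue (hc : 0 < c) (hg : PermutesBelow (m + 1) g)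
    (hh : PermutesBelow c h) (hgm : g m ≠ m) (hh0 : h 0 ≠ 0) (ag : AvoidsBelow (m + 1) g)
    (ah : AvoidsBelow c h) : ∃ p q, OnlyOccBelow (m + c) (glue m g h) p m q := by
  have hgm' := hg.1 m (by omega)
  have hh0' := hh.1 0 hc
  obtain ⟨p, hp, hgp⟩ := hg.exists_eq (y := m) (by omega)
  obtain ⟨q, hq, hhq⟩ := hh.exists_eq hc
  have hpm : p < m := by
    rcases Nat.lt_succ_iff_lt_or_eq.1 hp with h' | rfl
    · exact h'
    · exact absurd hgp hgm
  have hq0 : 0 < q := Nat.pos_of_ne_zero (by rintro rfl; exact hh0 hhq)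
  have fp : glue m g h p = m + h 0 := by rw [glue_of_lt hpm, if_pos hgp]
  have fq : glue m g h (m + q) = g m := by rw [glue_add hq0, if_pos hhq]
  have fleft : ∀ i < m, i ≠ p → glue m g h i = g i ∧ g i < m := by
    intro i hi hip
    have := hg.1 i (by omega)
    have := hg.2 i (by omega) p hp
    have : g i ≠ m := by omega
    exact ⟨by rw [glue_of_lt hi, if_neg this], by omega⟩
  have fright : ∀ i, 0 < i → i < c → i ≠ q → glue m g h (m + i) = m + h i ∧ 0 < h i := by
    intro i hi hic hiq
    have := hh.2 i (by omega) q hq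
    have : h i ≠ 0 := by omega
    exact ⟨by rw [glue_add hi, if_neg this], by omega⟩
  refine ⟨p, m + q, hpm, by omega, by omega, by rw [fq, glue_self]; omega,
    by rw [fp, glue_self]; omega, ?_⟩
  intro i s k his hsk hk h1 h2
  rcases lt_trichotomy s m with hsm | rfl | hsm
  · -- the middle entry lies left of `m`
    exfalso
    have hsp : s ≠ p := by
      rintro rfl
      have := fleft i (by omega) (by omega)
      omega
    have hs := fleft s hsm hsp
    have hi : g s < g i := by
      by_cases hip : i = p
      · subst hip; omega
      · have := fleft i (by omega) hip; omega
    rcases lt_trichotomy k m with hkm | rfl | hkm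
    · have hkp : k ≠ p := by rintro rfl; omega
      have := fleft k hkm hkp
      exact ag i s k his hsk (by omega) (by omega) hi
    · rw [glue_self] at h1; omega
    · obtain ⟨k, rfl⟩ := Nat.exists_eq_add_of_lt hkm
      rw [add_assoc] at h1
      by_cases hkq : k + 1 = q
      · rw [hkq] at h1
        exact ag i s m his hsm (by omega) (by omega) hi
      · have := fright (k + 1) (by omega) (by omega) hkq
        omega
  · rw [glue_self] at h1 h2
    refine ⟨?_, rfl, ?_⟩
    · by_contra hip
      have := fleft i his hip
      omega
    · by_contra hkq
      obtain ⟨k, rfl⟩ := Nat.exists_eq_add_of_lt hsk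
      rw [add_assoc] at h1
      have := fright (k + 1) (by omega) (by omega) (by omega)
      omega
  · exfalso
    obtain ⟨s, rfl⟩ := Nat.exists_eq_add_of_lt hsm
    obtain ⟨k, rfl⟩ := Nat.exists_eq_add_of_lt (hsm.trans hsk)
    rw [add_assoc] at h1 h2
    rw [add_assoc] at h1
    have hsq : s + 1 ≠ q := by
      intro hsq
      have := fright (k + 1) (by omega) (by omega) (by omega)
      rw [hsq, fq] at h1
      omega
    have hs := fright (s + 1) (by omega) (by omega) hsq
    have hk' : h (k + 1) < h (s + 1) := by
      by_cases hkq : k + 1 = q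
      · rw [hkq]; omega
      · have := fright (k + 1) (by omega) (by omega) hkq; omega
    rcases lt_trichotomy i m with him | rfl | him
    · have hip : i = p := by
        by_contra hip
        have := fleft i him hip
        omega
      subst hip
      exact ah 0 (s + 1) (k + 1) (by omega) (by omega) (by omega) hk' (by omega)
    · rw [glue_self] at h2; omega
    · obtain ⟨i, rfl⟩ := Nat.exists_eq_add_of_lt him
      rw [add_assoc] at h2
      have hi : h (s + 1) < h (i + 1) := by
        by_cases hiq : i + 1 = q
        · rw [hiq] at h2; omega
        · have := fright (i + 1) (by omega) (by omega) hiq; omega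
      exact ah (i + 1) (s + 1) (k + 1) (by omega) (by omega) (by omega) hk' hi

lemma glue_injective {g' h' : ℕ → ℕ} (hc : 0 < c) (hg : PermutesBelow (m + 1) g)
    (hh : PermutesBelow c h) (hgm : g m ≠ m) (hh0 : h 0 ≠ 0) (hg' : PermutesBelow (m + 1) g')
    (hgm' : g' m ≠ m) (heq : ∀ i < m + c, glue m g h i = glue m g' h' i) :
    (∀ i < m + 1, g i = g' i) ∧ ∀ i < c, h i = h' i := by
  have hgm1 := hg.1 m (by omega)
  have hgm1' := hg'.1 m (by omega)
  obtain ⟨p, hp, hgp⟩ := hg.exists_eq (y := m) (by omega)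
  obtain ⟨q, hq, hhq⟩ := hh.exists_eq hc
  have hpm : p < m := by
    rcases Nat.lt_succ_iff_lt_or_eq.1 hp with h' | rfl
    · exact h'
    · exact absurd hgp hgm
  have hq0 : 0 < q := Nat.pos_of_ne_zero (by rintro rfl; exact hh0 hhq)
  constructor
  · intro i hi
    rcases Nat.lt_succ_iff_lt_or_eq.1 hi with him | rfl
    · have e := heq i (by omega)
      have := hg.1 i hi
      have := hg'.1 i hi
      rw [glue_of_lt him, glue_of_lt him] at e
      split_ifs at e <;> omega
    · have e := heq (i + q) (by omega)
      rw [glue_add hq0, glue_add hq0] at e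
      split_ifs at e <;> omega
  · intro i hi
    rcases Nat.eq_zero_or_pos i with rfl | hi0
    · have e := heq p (by omega)
      have := hg'.1 p (by omega)
      rw [glue_of_lt hpm, glue_of_lt hpm] at e
      split_ifs at e <;> omega
    · have e := heq (m + i) (by omega)
      rw [glue_add hi0, glue_add hi0] at e
      split_ifs at e <;> omega

end Glue

/-- The middle entry of the only occurrence of 321 is a fixed point. -/
lemma OnlyOccBelow.apply_mid {n p j q : ℕ} {f : ℕ → ℕ} (hf : PermutesBelow n f)
    (ho : OnlyOccBelow n f p j q) : f j = j := by
  obtain ⟨hpj, hjq, hqn, h1, h2, hu⟩ := ho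
  have left : ∀ i < j, i ≠ p → f i < f j := by
    intro i hi hip
    by_contra hlt
    have := hf.2 i (by omega) j (by omega)
    exact hip (hu i j q hi hjq hqn h1 (by omega)).1
  have right : ∀ i, j < i → i < n → i ≠ q → f j < f i := by
    intro i hi hin hiq
    by_contra hlt
    have := hf.2 i (by omega) j (by omega)
    exact hiq (hu p j i hpj hi hin (by omega) h2).2.2
  have hle : j ≤ f j := by
    have := Finset.card_le_card_of_injOn (s := Finset.range j) (t := Finset.range (f j))
      (fun i => if i = p then f q else f i)
      (by
        intro i hi
        have hi : i < j := by simpa using hi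
        have := left i hi
        simp only [Finset.coe_range, Set.mem_Iio]
        split_ifs with hip
        · exact h1
        · exact this hip)
      (by
        intro x hx y hy hxy
        have hx : x < j := by simpa using hx
        have hy : y < j := by simpa using hy
        have := hf.2 x (by omega) y (by omega)
        have := hf.2 x (by omega) q (by omega)
        have := hf.2 y (by omega) q (by omega)
        dsimp only at hxy
        split_ifs at hxy <;> omega)
    simpa using this
  have hge : n - 1 - j ≤ n - 1 - f j := by
    have := Finset.card_le_card_of_injOn (s := Finset.Ioo j n) (t := Finset.Ioo (f j) n)
      (fun i => if i = q then f p else f i)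
      (by
        intro i hi
        have hi : j < i ∧ i < n := by simpa using hi
        have := right i hi.1 hi.2
        have := hf.1 i hi.2
        have := hf.1 p (by omega)
        simp only [Finset.coe_Ioo, Set.mem_Ioo]
        split_ifs with hip <;> omega)
      (by
        intro x hx y hy hxy
        have hx : j < x ∧ x < n := by simpa using hx
        have hy : j < y ∧ y < n := by simpa using hy
        have := hf.2 x (by omega) y (by omega)
        have := hf.2 x (by omega) p (by omega)
        have := hf.2 y (by omega) p (by omega)
        dsimp only at hxy
        split_ifs at hxy <;> omega)
    simp only [Nat.card_Ioo] at this
    omega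
  have := hf.1 j (by omega)
  omega

lemma OnlyOccBelow.exists_glue {m c p j q : ℕ} {f : ℕ → ℕ} (hf : PermutesBelow (m + c) f)
    (ho : OnlyOccBelow (m + c) f p j q) (hm : f j = m) :
    ∃ g h, PermutesBelow (m + 1) g ∧ PermutesBelow c h ∧ AvoidsBelow (m + 1) g ∧
      AvoidsBelow c h ∧ g m ≠ m ∧ h 0 ≠ 0 ∧ ∀ i < m + c, f i = glue m g h i := by
  obtain rfl : j = m := by rw [← hm, ho.apply_mid hf]
  obtain ⟨hpj, hjq, hqn, h1, h2, hu⟩ := ho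
  obtain ⟨q, rfl⟩ := Nat.exists_eq_add_of_lt hjq
  rw [add_assoc] at *
  have left : ∀ i < j, i ≠ p → f i < j := by
    intro i hi hip
    by_contra hlt
    have := hf.2 i (by omega) j (by omega)
    exact hip (hu i j _ hi hjq hqn h1 (by omega)).1
  have right : ∀ i, 0 < i → i < c → i ≠ q + 1 → j < f (j + i) := by
    intro i hi hin hiq
    by_contra hlt
    have := hf.2 (j + i) (by omega) j (by omega)
    have := (hu p j (j + i) hpj (by omega) (by omega) (by omega) h2).2.2
    omega
  have hq0 := hf.1 _ hqn
  have hp0 := hf.1 p (by omega)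
  refine ⟨fun i => if i = j then f (j + (q + 1)) else if i = p then j else f i,
    fun i => if i = 0 then f p - j else if i = q + 1 then 0 else f (j + i) - j,
    ⟨?_, ?_⟩, ⟨?_, ?_⟩, ?_, ?_, ?_, ?_, ?_⟩
  · intro i hi
    have := left i
    dsimp only
    split_ifs <;> omega
  · intro x hx y hy hxy
    have := left x
    have := left y
    have := hf.2 x (by omega) y (by omega)
    have := hf.2 x (by omega) _ hqn
    have := hf.2 y (by omega) _ hqn
    dsimp only at hxy
    split_ifs at hxy <;> omega
  · intro i hi
    have := right i
    have := hf.1 (j + i) (by omega)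
    dsimp only
    split_ifs <;> omega
  · intro x hx y hy hxy
    have := right x
    have := right y
    have := hf.2 (j + x) (by omega) (j + y) (by omega)
    have := hf.2 (j + x) (by omega) p (by omega)
    have := hf.2 (j + y) (by omega) p (by omega)
    dsimp only at hxy
    split_ifs at hxy <;> omega
  · intro x s k hxs hsk hk ha hb
    have := left x
    have := left s
    have := left k
    have := hu x s k hxs hsk (by omega)
    have := hu x s (j + (q + 1)) hxs (by omega) (by omega)
    dsimp only at ha hb
    split_ifs at ha hb <;> subst_vars <;> omega
  · intro x s k hxs hsk hk ha hb
    have := right x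
    have := right s
    have := right k
    have := hu (j + x) (j + s) (j + k) (by omega) (by omega) (by omega)
    have := hu p (j + s) (j + k) (by omega) (by omega) (by omega)
    dsimp only at ha hb
    split_ifs at ha hb <;> subst_vars <;> omega
  · simp only [if_true]; omega
  · simp only [if_true]; omega
  · intro i hi
    rcases lt_trichotomy i j with him | rfl | him
    · have := left i him
      rw [glue_of_lt him]
      simp only [if_true]
      split_ifs <;> subst_vars <;> omega
    · rw [glue_self, hm]
    · obtain ⟨i, rfl⟩ := Nat.exists_eq_add_of_lt him
      rw [add_assoc, glue_add (by omega)]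
      have := right (i + 1) (by omega) (by omega)
      simp only [if_true]
      rcases eq_or_ne i q with rfl | hiq
      · simp
      · have hlt := this (by omega)
        simp [hiq, Nat.sub_ne_zero_of_lt hlt, hlt.le]

/-- The permutation `σ` of `Fin n`, as a function on the natural numbers below `n`. -/
def natFun {n : ℕ} (σ : Equiv.Perm (Fin n)) (i : ℕ) : ℕ :=
  if h : i < n then σ ⟨i, h⟩ else i

section NatFun

variable {n : ℕ} (σ : Equiv.Perm (Fin n))

lemma natFun_of_lt {i : ℕ} (h : i < n) : natFun σ i = σ ⟨i, h⟩ := dif_pos h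

lemma natFun_val (i : Fin n) : natFun σ i = σ i := natFun_of_lt σ i.2

lemma permutesBelow_natFun : PermutesBelow n (natFun σ) := by
  refine ⟨fun i hi => by simp [natFun_of_lt σ hi], fun i hi j hj h => ?_⟩
  rw [natFun_of_lt σ hi, natFun_of_lt σ hj] at h
  simpa using σ.injective (Fin.ext h)

variable {σ}

lemma perm_eq_of_natFun_eq {τ : Equiv.Perm (Fin n)} (h : ∀ i < n, natFun σ i = natFun τ i) :
    σ = τ :=
  Equiv.ext fun i => Fin.ext (by rw [← natFun_val, ← natFun_val, h i i.2])

lemma avoids321_iff_natFun : Avoids321 σ ↔ AvoidsBelow n (natFun σ) := by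
  constructor
  · intro h i j k hij hjk hk h1 h2
    rw [natFun_of_lt σ (by omega), natFun_of_lt σ (by omega)] at h1 h2
    exact h ⟨(⟨i, by omega⟩, ⟨j, by omega⟩, ⟨k, hk⟩), hij, hjk, h2, h1⟩
  · rintro h ⟨⟨i, j, k⟩, hij, hjk, h2, h1⟩
    exact h i j k hij hjk k.2 (by simpa [natFun_val] using h1) (by simpa [natFun_val] using h2)

lemma exactlyOne321_iff_natFun {m : ℕ} :
    (ExactlyOne321 σ ∧ ∀ t : Fin n × Fin n × Fin n, Occ321 σ t → (σ t.2.1 : ℕ) = m) ↔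
      ∃ p j q, natFun σ j = m ∧ OnlyOccBelow n (natFun σ) p j q := by
  constructor
  · rintro ⟨⟨⟨p, j, q⟩, ⟨hpj, hjq, h1, h2⟩, hu⟩, hm⟩
    refine ⟨p, j, q, ?_, hpj, hjq, q.2, by simpa [natFun_val] using h2,
      by simpa [natFun_val] using h1, ?_⟩
    · rw [natFun_val]
      exact hm (p, j, q) ⟨hpj, hjq, h1, h2⟩
    · intro x s k hxs hsk hk ha hb
      rw [natFun_of_lt σ (by omega), natFun_of_lt σ (by omega)] at ha hb
      have := hu (⟨x, by omega⟩, ⟨s, by omega⟩, ⟨k, hk⟩) ⟨hxs, hsk, hb, ha⟩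
      simp only [Prod.mk.injEq, Fin.ext_iff] at this
      exact this
  · rintro ⟨p, j, q, hm, hpj, hjq, hq, h1, h2, hu⟩
    have huniq : ∀ t : Fin n × Fin n × Fin n, Occ321 σ t →
        t = (⟨p, by omega⟩, ⟨j, by omega⟩, ⟨q, hq⟩) := by
      rintro ⟨x, s, k⟩ ⟨hxs, hsk, hb, ha⟩
      have := hu x s k hxs hsk k.2 (by simpa [natFun_val] using ha)
        (by simpa [natFun_val] using hb)
      simpa [Fin.ext_iff] using this
    rw [natFun_of_lt σ (by omega), natFun_of_lt σ (by omega)] at h1 h2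
    refine ⟨⟨_, ⟨hpj, hjq, h2, h1⟩, huniq⟩, fun t ht => ?_⟩
    rw [huniq t ht, ← natFun_val, hm]

end NatFun

/-- The permutation of `Fin n` obtained from a function that permutes the numbers below `n`. -/
noncomputable def PermutesBelow.toPerm {n : ℕ} {f : ℕ → ℕ} (hf : PermutesBelow n f) :
    Equiv.Perm (Fin n) :=
  Equiv.ofBijective (fun i => ⟨f i, hf.1 i i.2⟩) (Finite.injective_iff_bijective.1
    fun i j h => Fin.ext (hf.2 i i.2 j j.2 (by simpa using h)))

lemma PermutesBelow.natFun_toPerm {n : ℕ} {f : ℕ → ℕ} (hf : PermutesBelow n f) {i : ℕ}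
    (hi : i < n) : natFun hf.toPerm i = f i := by
  rw [natFun_of_lt _ hi]; rfl

lemma AvoidsBelow.congr {n : ℕ} {f g : ℕ → ℕ} (h : ∀ i < n, f i = g i) (hf : AvoidsBelow n f) :
    AvoidsBelow n g := by
  intro i j k hij hjk hk h1 h2
  rw [← h _ (by omega), ← h _ (by omega)] at h1 h2
  exact hf i j k hij hjk hk h1 h2

lemma OnlyOccBelow.congr {n p j q : ℕ} {f g : ℕ → ℕ} (h : ∀ i < n, f i = g i)
    (hf : OnlyOccBelow n f p j q) : OnlyOccBelow n g p j q := by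
  obtain ⟨hpj, hjq, hq, h1, h2, hu⟩ := hf
  rw [h _ (by omega), h _ (by omega)] at h1 h2
  refine ⟨hpj, hjq, hq, h1, h2, ?_⟩
  intro i j k hij hjk hk h1 h2
  rw [← h _ (by omega), ← h _ (by omega)] at h1 h2
  exact hu i j k hij hjk hk h1 h2

lemma nonempty_equiv_exactlyOne321 (n m c : ℕ) (hn : n = m + c) (hc : 0 < c) :
    Nonempty
      ({π : Equiv.Perm (Fin n) //
          ExactlyOne321 π ∧ ∀ t : Fin n × Fin n × Fin n, Occ321 π t → (π t.2.1 : ℕ) + 1 = m + 1} ≃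
        {p : Equiv.Perm (Fin (m + 1)) × Equiv.Perm (Fin c) //
          Avoids321 p.1 ∧ p.1 ⟨m, m.lt_succ_self⟩ ≠ ⟨m, m.lt_succ_self⟩ ∧
            Avoids321 p.2 ∧ p.2 ⟨0, hc⟩ ≠ ⟨0, hc⟩}) := by
  subst hn
  simp only [add_left_inj, exactlyOne321_iff_natFun, avoids321_iff_natFun, ne_eq, Fin.ext_iff,
    ← natFun_of_lt]
  have hglue : ∀ p : {p : Equiv.Perm (Fin (m + 1)) × Equiv.Perm (Fin c) //
      AvoidsBelow (m + 1) (natFun p.1) ∧ ¬natFun p.1 m = m ∧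
        AvoidsBelow c (natFun p.2) ∧ ¬natFun p.2 0 = 0},
      PermutesBelow (m + c) (glue m (natFun p.1.1) (natFun p.1.2)) := fun p =>
    permutesBelow_glue hc (permutesBelow_natFun _) (permutesBelow_natFun _) p.2.2.1 p.2.2.2.2
  have hmem : ∀ p, ∃ x j y, natFun (hglue p).toPerm j = m ∧
      OnlyOccBelow (m + c) (natFun (hglue p).toPerm) x j y := by
    intro p
    obtain ⟨x, y, h⟩ := exists_onlyOccBelow_glue hc (permutesBelow_natFun _)
      (permutesBelow_natFun _) p.2.2.1 p.2.2.2.2 p.2.1 p.2.2.2.1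
    refine ⟨x, m, y, ?_, h.congr fun i hi => ((hglue p).natFun_toPerm hi).symm⟩
    rw [(hglue p).natFun_toPerm (by omega), glue_self]
  refine ⟨(Equiv.ofBijective (fun p => ⟨(hglue p).toPerm, hmem p⟩) ⟨?_, ?_⟩).symm⟩
  · intro p p' h
    have h : (hglue p).toPerm = (hglue p').toPerm := congrArg Subtype.val h
    obtain ⟨h1, h2⟩ := glue_injective hc (permutesBelow_natFun p.1.1) (permutesBelow_natFun p.1.2)
      p.2.2.1 p.2.2.2.2 (permutesBelow_natFun p'.1.1) p'.2.2.1 (h' := natFun p'.1.2)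
      fun i hi => by rw [← (hglue p).natFun_toPerm hi, ← (hglue p').natFun_toPerm hi, h]
    exact Subtype.ext (Prod.ext (perm_eq_of_natFun_eq h1) (perm_eq_of_natFun_eq h2))
  · rintro ⟨π, p, j, q, hm, ho⟩
    obtain ⟨g, h, hg, hh, ag, ah, hgm, hh0, he⟩ := ho.exists_glue (permutesBelow_natFun π) hm
    have eg : ∀ i < m + 1, natFun hg.toPerm i = g i := fun i hi => hg.natFun_toPerm hi
    have eh : ∀ i < c, natFun hh.toPerm i = h i := fun i hi => hh.natFun_toPerm hi
    refine ⟨⟨(hg.toPerm, hh.toPerm), ag.congr fun i hi => (eg i hi).symm, ?_,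
      ah.congr fun i hi => (eh i hi).symm, ?_⟩, Subtype.ext (perm_eq_of_natFun_eq ?_)⟩
    · rwa [eg m (by omega)]
    · rwa [eh 0 hc]
    · intro i hi
      rw [(hglue _).natFun_toPerm hi, he i hi]
      dsimp only [glue]
      rw [eh 0 hc, eg m (by omega)]
      split_ifs with h1 h2 h3 h4 h5 h6 <;> first
        | rfl
        | (exfalso; rw [eg i (by omega)] at *; omega)
        | (exfalso; rw [eh (i - m) (by omega)] at *; omega)
        | rw [eg i (by omega)]
        | rw [eh (i - m) (by omega)]

/-- The values of `σ` below `q` appear in increasing order. -/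
def SortedBelow {n : ℕ} (σ : Equiv.Perm (Fin n)) (q : ℕ) : Prop :=
  ∀ j k, j < k → σ k < σ j → q ≤ (σ j : ℕ)

lemma sortedBelow_zero {n : ℕ} (σ : Equiv.Perm (Fin n)) : SortedBelow σ 0 :=
  fun _ _ _ _ => Nat.zero_le _

lemma sortedBelow_one {n : ℕ} (σ : Equiv.Perm (Fin n)) : SortedBelow σ 1 :=
  fun _ _ _ h => Nat.one_le_iff_ne_zero.2 (Nat.ne_zero_of_lt h)

/-- The permutation of `Fin (n + 1)` with first value `p` whose other values are ordered as
those of `σ`. -/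
def consPerm {n : ℕ} (p : Fin (n + 1)) (σ : Equiv.Perm (Fin n)) : Equiv.Perm (Fin (n + 1)) :=
  (finSuccEquiv' 0).trans ((Equiv.optionCongr σ).trans (finSuccEquiv' p).symm)

section ConsPerm

variable {n : ℕ} (p : Fin (n + 1)) (σ : Equiv.Perm (Fin n))

@[simp]
lemma consPerm_zero : consPerm p σ 0 = p := by simp [consPerm]

@[simp]
lemma consPerm_succ (i : Fin n) : consPerm p σ i.succ = p.succAbove (σ i) := by
  have h : finSuccEquiv' 0 i.succ = some i := finSuccEquiv_succ i
  simp [consPerm, h]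

lemma consPerm_bijective :
    Function.Bijective fun x : Fin (n + 1) × Equiv.Perm (Fin n) => consPerm x.1 x.2 := by
  rw [Fintype.bijective_iff_injective_and_card]
  constructor
  · rintro ⟨p, σ⟩ ⟨p', σ'⟩ h
    dsimp only at h
    obtain rfl : p = p' := by rw [← consPerm_zero p σ, h, consPerm_zero]
    refine Prod.ext rfl (Equiv.ext fun i => p.succAbove_right_injective ?_)
    rw [← consPerm_succ, h, consPerm_succ]
  · simp [Fintype.card_perm, Nat.factorial_succ]

variable {p σ}

lemma avoids321_consPerm : Avoids321 (consPerm p σ) ↔ Avoids321 σ ∧ SortedBelow σ p := by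
  constructor
  · intro h
    constructor
    · rintro ⟨⟨i, j, k⟩, hij, hjk, h1, h2⟩
      exact h ⟨(i.succ, j.succ, k.succ), by simpa [Occ321] using ⟨hij, hjk, h1, h2⟩⟩
    · intro j k hjk hkj
      by_contra hlt
      refine h ⟨(0, j.succ, k.succ), ?_⟩
      have : (σ j).castSucc < p := by simpa [Fin.lt_def] using hlt
      simpa [Occ321, hjk, hkj] using Fin.succAbove_lt_iff_castSucc_lt _ _ |>.2 this
  · rintro ⟨ha, hs⟩ ⟨⟨i, j, k⟩, hij, hjk, h1, h2⟩
    dsimp only at hij hjk h1 h2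
    obtain ⟨j, rfl⟩ := Fin.exists_succ_eq.2 (Fin.ne_zero_of_lt hij)
    obtain ⟨k, rfl⟩ := Fin.exists_succ_eq.2 (Fin.ne_zero_of_lt hjk)
    rw [Fin.succ_lt_succ_iff] at hjk
    rw [consPerm_succ, consPerm_succ, Fin.succAbove_lt_succAbove_iff] at h2
    induction i using Fin.cases with
    | zero =>
      rw [consPerm_succ, consPerm_zero, Fin.succAbove_lt_iff_castSucc_lt] at h1
      exact absurd (hs j k hjk h2) (by simpa [Fin.lt_def] using h1)
    | succ i =>
      rw [consPerm_succ, consPerm_succ, Fin.succAbove_lt_succAbove_iff] at h1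
      exact ha ⟨(i, j, k), by simpa using hij, hjk, h1, h2⟩

lemma val_succAbove (p : Fin (n + 1)) (i : Fin n) :
    (p.succAbove i : ℕ) = if (i : ℕ) < p then (i : ℕ) else i + 1 := by
  simp only [Fin.succAbove, Fin.lt_def, Fin.val_castSucc]
  split_ifs <;> simp

lemma sortedBelow_consPerm {q : ℕ} (hs : SortedBelow σ p) :
    SortedBelow (consPerm p σ) (q + 1) ↔ q + 1 ≤ p ∨ (p = 0 ∧ SortedBelow σ q) := by
  constructor
  · intro h
    rcases eq_or_ne p 0 with rfl | hp
    · refine Or.inr ⟨rfl, fun j k hjk hkj => ?_⟩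
      simpa using h j.succ k.succ (by simpa using hjk) (by simpa using hkj)
    · obtain ⟨k, hk⟩ := (consPerm p σ).surjective 0
      have hk0 : 0 < k := Fin.pos_of_ne_zero (by rintro rfl; exact hp (by simpa using hk))
      left
      simpa using h 0 k hk0 (by rw [hk, consPerm_zero]; exact Fin.pos_of_ne_zero hp)
  · intro h j k hjk hkj
    obtain ⟨k, rfl⟩ := Fin.exists_succ_eq.2 (Fin.ne_zero_of_lt hjk)
    induction j using Fin.cases with
    | zero =>
      rcases h with h | ⟨rfl, -⟩
      · simpa using h
      · simp at hkj
    | succ j =>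
      rw [consPerm_succ, consPerm_succ, Fin.succAbove_lt_succAbove_iff] at hkj
      rw [Fin.succ_lt_succ_iff] at hjk
      have h1 := hs j k hjk hkj
      rw [consPerm_succ, val_succAbove]
      rcases h with h | ⟨rfl, h⟩
      · split_ifs <;> omega
      · have := h j k hjk hkj
        simpa using this

end ConsPerm

lemma card_filter_perm_succ {n : ℕ} (P : Equiv.Perm (Fin (n + 1)) → Prop) [DecidablePred P] :
    (Finset.univ.filter P).card =
      ∑ p : Fin (n + 1),
        (Finset.univ.filter fun σ : Equiv.Perm (Fin n) => P (consPerm p σ)).card := by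
  simp only [Finset.card_filter]
  rw [← (consPerm_bijective (n := n)).sum_comp, Fintype.sum_prod_type]

open Classical in
/-- The number of 321-avoiding permutations of `Fin n` whose values below `q` appear in increasing
order. -/
noncomputable def avoidSortedCount (n q : ℕ) : ℕ :=
  (Finset.univ.filter fun σ : Equiv.Perm (Fin n) => Avoids321 σ ∧ SortedBelow σ q).card

lemma avoidSortedCount_zero_left (q : ℕ) : avoidSortedCount 0 q = 1 := by
  classical
  rw [avoidSortedCount, Finset.filter_true_of_mem]
  · simp
  · rintro σ -
    exact ⟨fun ⟨t, _⟩ => t.1.elim0, fun j => j.elim0⟩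

lemma avoidSortedCount_one (n : ℕ) : avoidSortedCount n 1 = avoidSortedCount n 0 := by
  classical
  unfold avoidSortedCount
  exact congrArg _ (Finset.filter_congr fun σ _ =>
    and_congr_right fun _ => iff_of_true (sortedBelow_one σ) (sortedBelow_zero σ))

lemma avoidSortedCount_succ_succ {n q : ℕ} (hq : q ≤ n) :
    avoidSortedCount (n + 1) (q + 1) = ∑ p ∈ Finset.Ico q (n + 1), avoidSortedCount n p := by
  classical
  have hterm : ∀ p : Fin (n + 1), (Finset.univ.filter fun σ : Equiv.Perm (Fin n) =>
      Avoids321 (consPerm p σ) ∧ SortedBelow (consPerm p σ) (q + 1)).card =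
        (if q + 1 ≤ (p : ℕ) then avoidSortedCount n p else 0) +
          if (p : ℕ) = 0 then avoidSortedCount n q else 0 := by
    intro p
    have hrw : ∀ σ : Equiv.Perm (Fin n),
        (Avoids321 (consPerm p σ) ∧ SortedBelow (consPerm p σ) (q + 1)) ↔
          (Avoids321 σ ∧ SortedBelow σ p) ∧ (q + 1 ≤ (p : ℕ) ∨ (p = 0 ∧ SortedBelow σ q)) := by
      intro σ
      rw [avoids321_consPerm]
      exact and_congr_right fun h => sortedBelow_consPerm h.2
    simp only [hrw]
    rcases eq_or_ne p 0 with rfl | hp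
    · rw [Fin.val_zero, if_neg q.not_succ_le_zero, if_pos rfl, zero_add, avoidSortedCount]
      refine congrArg _ (Finset.filter_congr fun σ _ => ?_)
      simp [sortedBelow_zero]
    · by_cases hqp : q + 1 ≤ (p : ℕ)
      · simp [avoidSortedCount, hp, hqp]
      · simp [hp, hqp]
  rw [avoidSortedCount, card_filter_perm_succ]
  simp only [hterm]
  rw [Fin.sum_univ_eq_sum_range (fun p => (if q + 1 ≤ p then avoidSortedCount n p else 0) +
    if p = 0 then avoidSortedCount n q else 0), Finset.sum_add_distrib, Finset.sum_ite_eq',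
    if_pos (by simp), ← Finset.sum_filter, Finset.sum_eq_sum_Ico_succ_bot (by omega), add_comm]
  congr 2
  ext p
  simp only [Finset.mem_filter, Finset.mem_range, Finset.mem_Ico]
  omega

lemma avoidSortedCount_add_choose (n r : ℕ) (hr : r ≤ n) :
    avoidSortedCount n (n - r) + (n + r).choose (n + 1) = (n + r).choose n := by
  induction n generalizing r with
  | zero => simp [avoidSortedCount_zero_left, Nat.le_zero.1 hr]
  | succ n ih =>
    have main : ∀ r ≤ n, avoidSortedCount (n + 1) (n - r + 1) + (n + 1 + r).choose (n + 2) =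
        (n + 1 + r).choose (n + 1) := by
      intro r hr
      rw [avoidSortedCount_succ_succ (by omega)]
      induction r with
      | zero =>
        have := ih 0 (by omega)
        simpa using this
      | succ r ihr =>
        have h1 := ihr (by omega)
        have h2 := ih (r + 1) hr
        rw [Finset.sum_eq_sum_Ico_succ_bot (by omega), show n - (r + 1) + 1 = n - r by omega,
          ← add_assoc (n + 1) r 1, Nat.choose_succ_succ' (n + 1 + r) (n + 1),
          Nat.choose_succ_succ' (n + 1 + r) n]
        rw [show n + (r + 1) = n + 1 + r by ring] at h2
        rw [show n + 2 = n + 1 + 1 by rfl] at h1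
        omega
    rcases Nat.le_succ_iff.1 hr with hr | rfl
    · rw [Nat.succ_sub hr]
      exact main r hr
    · have h := main n le_rfl
      rw [Nat.sub_self] at h ⊢
      rw [zero_add, avoidSortedCount_one, show n + 2 = n + 1 + 1 by rfl] at h
      have hsymm : (n + 1 + n).choose n = (n + 1 + n).choose (n + 1) :=
        Nat.choose_symm_add.symm
      rw [show n + 1 + n.succ = n + 1 + n + 1 by rfl, Nat.choose_succ_succ' (n + 1 + n) (n + 1),
        Nat.choose_succ_succ' (n + 1 + n) n]
      omega

open Classical in
lemma card_avoids321 (n : ℕ) :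
    (Finset.univ.filter fun σ : Equiv.Perm (Fin n) => Avoids321 σ).card = catalan n := by
  have h := avoidSortedCount_add_choose n n le_rfl
  simp only [avoidSortedCount, Nat.sub_self, sortedBelow_zero, and_true] at h
  have h1 := Nat.choose_succ_right_eq (n + n) n
  have h2 := succ_mul_catalan_eq_centralBinom n
  rw [Nat.centralBinom, two_mul] at h2
  rw [Nat.add_sub_cancel] at h1
  refine Nat.eq_of_mul_eq_mul_left n.succ_pos ?_
  rw [Nat.succ_eq_add_one, h2]
  linear_combination (n + 1) * h - h1

open Classical in
lemma card_avoids321_fix_zero (n : ℕ) :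
    (Finset.univ.filter fun σ : Equiv.Perm (Fin (n + 1)) => Avoids321 σ ∧ σ 0 = 0).card =
      catalan n := by
  rw [card_filter_perm_succ, Finset.sum_eq_single 0]
  · simp [avoids321_consPerm, sortedBelow_zero, card_avoids321]
  · intro p _ hp
    simp [hp]
  · simp

lemma card_avoids321_not_fix_zero (n : ℕ) :
    (Nat.card {σ : Equiv.Perm (Fin (n + 1)) // Avoids321 σ ∧ σ 0 ≠ 0} : ℤ) =
      catalan (n + 1) - catalan n := by
  classical
  rw [Nat.card_eq_fintype_card, Fintype.card_subtype, ← card_avoids321 (n + 1),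
    ← card_avoids321_fix_zero n, eq_sub_iff_add_eq,
    ← Finset.card_filter_add_card_filter_not (s := Finset.univ.filter
      fun σ : Equiv.Perm (Fin (n + 1)) => Avoids321 σ) (fun σ => σ 0 = 0),
    Finset.filter_filter, Finset.filter_filter, Nat.cast_add, add_comm]

lemma avoids321_revPerm_conj {n : ℕ} {σ : Equiv.Perm (Fin n)} (h : Avoids321 σ) :
    Avoids321 (Fin.revPerm.permCongr σ) := by
  rintro ⟨⟨i, j, k⟩, hij, hjk, h1, h2⟩
  exact h ⟨(k.rev, j.rev, i.rev), by simpa using hjk, by simpa using hij, by simpa using h2,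
    by simpa using h1⟩

lemma card_avoids321_not_fix_last (n : ℕ) :
    (Nat.card {σ : Equiv.Perm (Fin (n + 1)) // Avoids321 σ ∧ σ (Fin.last n) ≠ Fin.last n} : ℤ) =
      catalan (n + 1) - catalan n := by
  rw [← card_avoids321_not_fix_zero]
  congr 1
  refine Nat.card_congr (Fin.revPerm.permCongr.subtypeEquiv fun σ => and_congr ⟨?_, ?_⟩ ?_)
  · exact avoids321_revPerm_conj
  · intro h
    convert avoids321_revPerm_conj h
    ext i
    simp
  · simp [Fin.rev_eq_iff]

lemma card_pairs_avoids321 (m k : ℕ) :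
    (Nat.card {p : Equiv.Perm (Fin (m + 1)) × Equiv.Perm (Fin (k + 1)) //
      Avoids321 p.1 ∧ p.1 ⟨m, m.lt_succ_self⟩ ≠ ⟨m, m.lt_succ_self⟩ ∧
        Avoids321 p.2 ∧ p.2 ⟨0, k.succ_pos⟩ ≠ ⟨0, k.succ_pos⟩} : ℤ) =
      ((catalan (m + 1) : ℤ) - catalan m) * ((catalan (k + 1) : ℤ) - catalan k) := by
  rw [← card_avoids321_not_fix_last, ← card_avoids321_not_fix_zero, ← Nat.cast_mul, ← Nat.card_prod]
  congr 1
  refine Nat.card_congr (Equiv.trans (Equiv.subtypeEquivRight fun p => ?_)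
    Equiv.subtypeProdEquivProd)
  exact and_assoc.symm

/-- For `2 ≤ b ≤ n - 1`, there is a bijection between permutations of `{1, …, n}`
containing 321 exactly once whose unique occurrence has middle value `b`, and pairs
`(σ₁, σ₂)` where `σ₁` is a 321-avoiding permutation of `{1, …, b}` not ending in `b`
and `σ₂` is a 321-avoiding permutation of `{b, …, n}` not starting with `b`.
`Fin n` represents `{1, …, n}` (`i` encodes `i + 1`), so the value `b` is encoded by
`⟨b - 1, _⟩`; likewise `Fin b` represents `{1, …, b}`, and `Fin (n - b + 1)` represents
`{b, …, n}` (`i` encodes `b + i`, so the value `b` is encoded by `⟨0, _⟩`).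
In particular, the number of such permutations is
`(C_b − C_{b−1}) · (C_{n−b+1} − C_{n−b})`. -/
theorem burstein_bijection (n b : ℕ) (hn : 1 ≤ n) (hb : 2 ≤ b) (hbn : b ≤ n - 1) :
    Nonempty
      ({π : Equiv.Perm (Fin n) //
          ExactlyOne321 π ∧
            ∀ t : Fin n × Fin n × Fin n, Occ321 π t → ((π t.2.1 : ℕ) + 1 = b)} ≃
        {p : Equiv.Perm (Fin b) × Equiv.Perm (Fin (n - b + 1)) //
          Avoids321 p.1 ∧ p.1 ⟨b - 1, by omega⟩ ≠ ⟨b - 1, by omega⟩ ∧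
            Avoids321 p.2 ∧ p.2 ⟨0, by omega⟩ ≠ ⟨0, by omega⟩}) ∧
      (Nat.card {π : Equiv.Perm (Fin n) //
          ExactlyOne321 π ∧
            ∀ t : Fin n × Fin n × Fin n, Occ321 π t → ((π t.2.1 : ℕ) + 1 = b)} : ℤ) =
        ((catalan b : ℤ) - catalan (b - 1)) *
          ((catalan (n - b + 1) : ℤ) - catalan (n - b)) := by
  obtain ⟨m, rfl⟩ : ∃ m, b = m + 1 := ⟨b - 1, by omega⟩
  obtain ⟨e⟩ := nonempty_equiv_exactlyOne321 n m (n - (m + 1) + 1) (by omega) (by omega)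
  exact ⟨⟨e⟩, by rw [Nat.card_congr e]; exact card_pairs_avoids321 m (n - (m + 1))⟩
end
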